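/- arXiv:2410.19541 — 6 statements merged into one kernel-verified Lean document; each statement's English description precedes it below -/
import Mathlib

section
/- Let d, D₁, D, L, N be positive natural numbers, and let A : Fin d → Matrix (Fin D₁) (Fin D₁) ℂ be a tensor that is injective after blocking L sites. Suppose N > L·(log₂ D + 3), and suppose the translationally invariant MPS ψ_N(A) on N sites has the exact MPS-up property with bound D. Then D₁ = 1; in particular there exists φ : Fin d → ℂ such that ψ_N(A)(i) = ∏_{n} φ(i n) for all i : Fin N → Fin d, i.e. ψ_N(A) is a product state of the form φ^{⊗N}. -/
/-- The matrix of a state `ψ` across the bipartition `(S, Sᶜ)` of the sites. -/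
noncomputable def schmidtMat {N d : ℕ} (ψ : (Fin N → Fin d) → ℂ) (S : Finset (Fin N)) :
    Matrix ({n : Fin N // n ∈ S} → Fin d) ({n : Fin N // n ∉ S} → Fin d) ℂ :=
  fun j k => ψ fun n => if h : n ∈ S then j ⟨n, h⟩ else k ⟨n, h⟩

/-- The Schmidt rank of `ψ` across the subset `S` of sites. -/
noncomputable def schmidtRank {N d : ℕ} (ψ : (Fin N → Fin d) → ℂ) (S : Finset (Fin N)) : ℕ :=
  (schmidtMat ψ S).rank

/-- The translationally invariant MPS with site tensor `A` on `N` sites. -/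
noncomputable def psiTI (N : ℕ) {d D₁ : ℕ} (A : Fin d → Matrix (Fin D₁) (Fin D₁) ℂ) :
    (Fin N → Fin d) → ℂ :=
  fun i => ((List.ofFn fun n => A (i n)).prod).trace

noncomputable def wordP {d D₁ : ℕ} (A : Fin d → Matrix (Fin D₁) (Fin D₁) ℂ) {n : ℕ}
    (i : Fin n → Fin d) : Matrix (Fin D₁) (Fin D₁) ℂ := (List.ofFn fun n => A (i n)).prod

def FullW {d D₁ : ℕ} (A : Fin d → Matrix (Fin D₁) (Fin D₁) ℂ) (n : ℕ) : Prop :=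
  ∀ X : Matrix (Fin D₁) (Fin D₁) ℂ, ∃ c : (Fin n → Fin d) → ℂ, ∑ i, c i • wordP A i = X

lemma wordP_cons {d D₁ : ℕ} (A : Fin d → Matrix (Fin D₁) (Fin D₁) ℂ) {n : ℕ}
    (a : Fin d) (i : Fin n → Fin d) :
    wordP A (Fin.cons a i : Fin (n+1) → Fin d) = A a * wordP A i := by
  simp [wordP, List.ofFn_succ]

lemma wordP_append {d D₁ : ℕ} (A : Fin d → Matrix (Fin D₁) (Fin D₁) ℂ) {n m : ℕ}
    (u : Fin n → Fin d) (v : Fin m → Fin d) :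
    wordP A (Fin.append u v) = wordP A u * wordP A v := by
  simp only [wordP]
  rw [← List.prod_append, ← List.ofFn_fin_append]
  congr 2
  funext k
  refine Fin.addCases (fun k => ?_) (fun k => ?_) k <;> simp

lemma fullW_of_inj {d D₁ L : ℕ} (A : Fin d → Matrix (Fin D₁) (Fin D₁) ℂ)
    (hinj : Function.Injective fun (X : Matrix (Fin D₁) (Fin D₁) ℂ) =>
      fun i : Fin L → Fin d => (X * (List.ofFn fun n => A (i n)).prod).trace) : FullW A L := by
  intro X
  rw [← Submodule.mem_span_range_iff_exists_fun]
  suffices h : Submodule.span ℂ (Set.range (wordP A (n := L))) = ⊤ by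
    rw [h]; trivial
  by_contra hne
  obtain ⟨f, hf, hle⟩ := Submodule.exists_le_ker_of_lt_top _ (lt_top_iff_ne_top.2 hne)
  have key : ∀ M, f M = ((Matrix.of fun b a => f (Matrix.single a b 1)) * M).trace := by
    intro M
    conv_lhs => rw [Matrix.matrix_eq_sum_single M]
    simp only [map_sum, Matrix.trace, Matrix.diag, Matrix.mul_apply, Matrix.of_apply]
    rw [Finset.sum_comm]
    refine Finset.sum_congr rfl fun b _ => Finset.sum_congr rfl fun a _ => ?_
    have : Matrix.single a b (M a b) = M a b • Matrix.single a b (1:ℂ) := by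
      simp [Matrix.smul_single]
    rw [this, map_smul, smul_eq_mul, mul_comm]
  have h0 : (Matrix.of fun b a => f (Matrix.single a b 1)) = 0 := by
    apply hinj
    funext i
    have h1 : f (wordP A i) = 0 := hle (Submodule.subset_span ⟨i, rfl⟩)
    rw [key] at h1
    simpa [wordP] using h1
  apply hf
  ext1 M
  rw [key, h0]; simp

lemma sum_cons {d n : ℕ} {β : Type*} [AddCommMonoid β] (f : (Fin (n+1) → Fin d) → β) :
    ∑ i, f i = ∑ a, ∑ v : Fin n → Fin d, f (Fin.cons a v : Fin (n+1) → Fin d) := by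
  rw [← Fintype.sum_prod_type', ← (Fin.consEquiv (fun _ : Fin (n+1) => Fin d)).sum_comp]
  rfl

lemma sum_append {d n m : ℕ} {β : Type*} [AddCommMonoid β] (f : (Fin (n+m) → Fin d) → β) :
    ∑ i, f i = ∑ u : Fin n → Fin d, ∑ v : Fin m → Fin d, f (Fin.append u v) := by
  rw [← Fintype.sum_prod_type', ← (Fin.appendEquiv n m).sum_comp]
  rfl

lemma fullW_succ {d D₁ n : ℕ} (A : Fin d → Matrix (Fin D₁) (Fin D₁) ℂ)
    (h : FullW A (n+1)) : FullW A (n+2) := by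
  intro X
  obtain ⟨c, hc⟩ := h 1
  rw [sum_cons] at hc
  choose e he using h
  refine ⟨fun i => e ((∑ v : Fin n → Fin d, c (Fin.cons (i 0) v : Fin (n+1) → Fin d) • wordP A v) * X) (Fin.tail i), ?_⟩
  rw [sum_cons]
  simp only [Fin.cons_zero, Fin.tail_cons, wordP_cons, ← Matrix.mul_smul, ← Finset.mul_sum, he]
  simp only [wordP_cons, ← Matrix.mul_smul, ← Finset.mul_sum] at hc
  simp only [← mul_assoc, ← Finset.sum_mul, hc, one_mul]

lemma fullW_ge {d D₁ L n : ℕ} (A : Fin d → Matrix (Fin D₁) (Fin D₁) ℂ) (hL : 0 < L)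
    (h : FullW A L) (hn : L ≤ n) : FullW A n := by
  induction n, hn using Nat.le_induction with
  | base => exact h
  | succ n hn ih =>
    obtain ⟨k, rfl⟩ : ∃ k, n = k + 1 := ⟨n - 1, by omega⟩
    exact fullW_succ A ih

lemma blocks {d D₁ L : ℕ} (A : Fin d → Matrix (Fin D₁) (Fin D₁) ℂ) (hL : 0 < L)
    (h : FullW A L) (m : ℕ) : ∀ N, (m+1) * L ≤ N →
    ∃ (g : Fin N → Fin (m+1))
      (w : Matrix (Fin D₁) (Fin D₁) ℂ → Fin (m+1) → (Fin N → Fin d) → ℂ),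
      (∀ X t i i', (∀ n, g n = t → i n = i' n) → w X t i = w X t i') ∧
      ∀ X : Fin (m+1) → Matrix (Fin D₁) (Fin D₁) ℂ,
        ∑ i, (∏ t, w (X t) t i) • wordP A i = (List.ofFn X).prod := by
  induction m with
  | zero =>
    intro N hN
    choose c hc using fullW_ge A hL h (by simpa using hN)
    refine ⟨fun _ => 0, fun X _ i => c X i, ?_, ?_⟩
    · intro X t i i' hi
      have : i = i' := funext fun n => hi n (by ext; omega)
      rw [this]
    · intro X
      simp [hc]
  | succ m ih =>
    intro N hN
    obtain ⟨N', rfl⟩ : ∃ N', N = L + N' := ⟨N - L, by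
      have : L ≤ (m+1+1) * L := Nat.le_mul_of_pos_left _ (by omega)
      omega⟩
    obtain ⟨g, w, hw, hs⟩ := ih N' (by
      have : (m+1+1) * L = (m+1)*L + L := by ring
      omega)
    choose c hc using h
    refine ⟨Fin.append (fun _ => 0) (fun n => (g n).succ),
      fun X t i => Fin.cases (motive := fun _ => ℂ) (c X (fun n => i (Fin.castAdd N' n)))
        (fun t => w X t (fun n => i (Fin.natAdd L n))) t, ?_, ?_⟩
    · intro X t i i'
      refine Fin.cases ?_ (fun t => ?_) t
      · intro hi
        simp only [Fin.cases_zero]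
        congr 1
        funext n
        apply hi
        simp
      · intro hi
        simp only [Fin.cases_succ]
        apply hw
        intro n hn
        apply hi
        simp [hn]
    · intro X
      rw [sum_append, List.ofFn_succ, List.prod_cons, ← hc (X 0), ← hs]
      simp only [Fin.prod_univ_succ, Fin.cases_zero, Fin.cases_succ, Fin.append_left,
        Fin.append_right, wordP_append]
      rw [Finset.sum_mul]
      refine Finset.sum_congr rfl fun u _ => ?_
      rw [Finset.mul_sum]
      refine Finset.sum_congr rfl fun v _ => ?_
      rw [Matrix.smul_mul, Matrix.mul_smul, smul_smul]

lemma prod_single {D₁ : ℕ} (n : ℕ) : ∀ (a b : Fin (n+1) → Fin D₁),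
    (List.ofFn (fun t => Matrix.single (a t) (b t) (1:ℂ))).prod =
      if ∀ t : Fin n, b t.castSucc = a t.succ then
        Matrix.single (a 0) (b (Fin.last n)) (1:ℂ) else 0 := by
  induction n with
  | zero => intro a b; simp
  | succ n ih =>
    intro a b
    rw [List.ofFn_succ, List.prod_cons, ih (fun t => a t.succ) (fun t => b t.succ)]
    simp only [Fin.forall_fin_succ (n := n), Fin.castSucc_zero, Fin.succ_last]
    by_cases h0 : b 0 = a (Fin.succ 0)
    · simp only [h0, true_and, mul_ite, mul_zero, Matrix.single_mul_single_same, mul_one,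
        ← Fin.succ_castSucc]
    · simp only [h0, false_and, if_false, mul_ite, mul_zero]
      rw [Matrix.single_mul_single_of_ne _ _ _ _ h0]
      simp

lemma trace_single {D₁ : ℕ} (n : ℕ) (a b : Fin (n+1) → Fin D₁) :
    (List.ofFn (fun t => Matrix.single (a t) (b t) (1:ℂ))).prod.trace =
      if ∀ t, b t = a (t+1) then 1 else 0 := by
  rw [prod_single]
  simp only [Fin.forall_fin_succ' (n := n), Fin.coeSucc_eq_succ, Fin.last_add_one]
  by_cases h : ∀ t : Fin n, b t.castSucc = a t.succ
  · by_cases h' : b (Fin.last n) = a 0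
    · simp [h, h']
    · simp [h, h', Matrix.trace_single_eq_of_ne _ _ _ (Ne.symm h')]
  · simp [h]

lemma trace_one (l : List (Matrix (Fin 1) (Fin 1) ℂ)) :
    l.prod.trace = (l.map (fun M => M 0 0)).prod := by
  induction l with
  | nil => simp
  | cons M l ih =>
    rw [List.prod_cons, List.map_cons, List.prod_cons, ← ih]
    simp [Matrix.trace, Matrix.mul_apply]

lemma rank_bound {d D₁ D L N p : ℕ} (hd : 0 < d)
    (A : Fin d → Matrix (Fin D₁) (Fin D₁) ℂ) (hL : 0 < L) (h : FullW A L)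
    (hp : (2 * p + 1 + 1) * L ≤ N)
    (hup : ∀ S : Finset (Fin N), schmidtRank (psiTI N A) S ≤ D) : D₁ ^ (2 * p + 2) ≤ D := by
  classical
  obtain ⟨g, w, hw, hs⟩ := blocks A hL h (2*p+1) N hp
  let S : Finset (Fin N) := Finset.univ.filter fun n => Even (g n).val
  let ι := Fin (2*p+1+1) → Fin D₁
  let E : ι → Fin (2*p+1+1) → Matrix (Fin D₁) (Fin D₁) ℂ :=
    fun x t => Matrix.single (x t) (x (t+1)) 1
  let U : Matrix ι ({n : Fin N // n ∈ S} → Fin d) ℂ := fun x j =>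
    ∏ t, if Even t.val then w (E x t) t (fun n => if h : n ∈ S then j ⟨n, h⟩ else ⟨0, hd⟩) else 1
  let V : Matrix ({n : Fin N // n ∉ S} → Fin d) ι ℂ := fun k y =>
    ∏ t, if Even t.val then 1 else
      w (E y t) t (fun n => if h : n ∈ S then ⟨0, hd⟩ else k ⟨n, h⟩)
  have hmul : U * schmidtMat (psiTI N A) S * V = 1 := by
    ext x y
    have h1 : (U * schmidtMat (psiTI N A) S * V) x y =
        ∑ i, (∏ t, w (if Even t.val then E x t else E y t) t i) * (wordP A i).trace := by
      rw [← (Equiv.piEquivPiSubtypeProd (fun n => n ∈ S) (fun _ => Fin d)).symm.sum_comp,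
        Fintype.sum_prod_type_right, Matrix.mul_apply]
      refine Finset.sum_congr rfl fun k _ => ?_
      rw [Matrix.mul_apply, Finset.sum_mul]
      refine Finset.sum_congr rfl fun j _ => ?_
      rw [mul_right_comm]
      congr 1
      rw [← Finset.prod_mul_distrib]
      refine Finset.prod_congr rfl fun t _ => ?_
      by_cases ht : Even t.val
      · simp only [ht, if_true, mul_one]
        apply hw
        intro n hn
        have : n ∈ S := by simp [S, hn, ht]
        simp [Equiv.piEquivPiSubtypeProd, this]
      · simp only [ht, if_false, one_mul]
        apply hw
        intro n hn
        have : n ∉ S := by simpa [S, hn] using ht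
        simp [Equiv.piEquivPiSubtypeProd, this]
    rw [h1]
    have h2 := congrArg Matrix.trace (hs (fun t => if Even t.val then E x t else E y t))
    rw [Matrix.trace_sum] at h2
    simp only [Matrix.trace_smul, smul_eq_mul] at h2
    rw [h2]
    have h3 : (fun t : Fin (2*p+1+1) => if Even t.val then E x t else E y t) =
      fun t => Matrix.single (if Even t.val then x t else y t)
        (if Even t.val then x (t+1) else y (t+1)) 1 := by
      funext t; split_ifs <;> rfl
    rw [h3, trace_single, Matrix.one_apply]
    congr 1
    rw [eq_iff_iff]
    have hpar : ∀ t : Fin (2*p+1+1), Even (t+1).val ↔ ¬ Even t.val := by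
      intro t
      rw [Fin.val_add_one]
      split_ifs with h
      · subst h
        simp
      · rw [Nat.even_add_one]
    constructor
    · intro hh
      funext s
      have := hh (s - 1)
      have e := hpar (s - 1)
      rw [sub_add_cancel] at this e
      by_cases hev : Even (s - 1).val
      · simpa [hev, e] using this
      · simpa [hev, e] using this.symm
    · rintro rfl t
      simp
  have hr := Matrix.rank_one (R := ℂ) (n := ι)
  rw [← hmul] at hr
  have hc : Fintype.card ι = D₁ ^ (2*p+2) := by simp [ι]
  rw [← hc, ← hr]
  exact ((Matrix.rank_mul_le_left _ _).trans (Matrix.rank_mul_le_right _ _)).trans (hup S)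

theorem statement_0
    (d D₁ D L N : ℕ) (hd : 0 < d) (hD₁ : 0 < D₁) (hD : 0 < D) (hL : 0 < L) (hN : 0 < N)
    (A : Fin d → Matrix (Fin D₁) (Fin D₁) ℂ)
    -- `A` is injective after blocking `L` sites
    (hinj : Function.Injective fun (X : Matrix (Fin D₁) (Fin D₁) ℂ) =>
      fun i : Fin L → Fin d => (X * (List.ofFn fun n => A (i n)).prod).trace)
    (hNbig : N > L * (Nat.log 2 D + 3))
    -- exact MPS-up property with bound `D`
    (hup : ∀ S : Finset (Fin N), schmidtRank (psiTI N A) S ≤ D) :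
    D₁ = 1 ∧ ∃ φ : Fin d → ℂ, ∀ i : Fin N → Fin d, psiTI N A i = ∏ n, φ (i n) := by
  have hfull := fullW_of_inj A hinj
  have h1 : D₁ = 1 := by
    by_contra hne
    have hb := rank_bound (p := (Nat.log 2 D + 1) / 2) hd A hL hfull (by
      refine le_trans ?_ hNbig.le
      rw [mul_comm]
      exact Nat.mul_le_mul_left _ (by omega)) hup
    have h2 : 2 ^ (Nat.log 2 D + 1) ≤ D₁ ^ (2 * ((Nat.log 2 D + 1) / 2) + 2) :=
      (Nat.pow_le_pow_right (by norm_num) (by omega)).trans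
        (Nat.pow_le_pow_left (by omega : 2 ≤ D₁) _)
    have h3 := Nat.lt_pow_succ_log_self (b := 2) (by norm_num) D
    simp only [Nat.succ_eq_add_one] at h3
    omega
  refine ⟨h1, ?_⟩
  subst h1
  refine ⟨fun a => A a 0 0, fun i => ?_⟩
  rw [psiTI, trace_one, List.map_ofFn, List.prod_ofFn]
  rfl
end

section
/- Let ψ be a unit vector in ℂ^{d_A} ⊗ ℂ^{d_B} with reduced density matrix ρ = Tr_B |ψ⟩⟨ψ| (partial trace over the second factor). Suppose there exists a unit vector φ in ℂ^{d_A} ⊗ ℂ^{d_B} with ‖ψ − φ‖ ≤ ε such that the reduced density matrix of φ, Tr_B |φ⟩⟨φ|, has rank at most D (i.e. φ has Schmidt rank at most D). Then the purity of ρ satisfies Tr[ρ²] ≥ 1/D − 4ε. -/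
/-- The ℓ²-norm of a coefficient tensor. -/
noncomputable def l2norm {ι : Type} [Fintype ι] (ψ : ι → ℂ) : ℝ :=
  Real.sqrt (∑ x, ‖ψ x‖ ^ 2)

/-- The density matrix `|ψ⟩⟨ψ|` of a vector `ψ`. -/
noncomputable def dyad {ι : Type} (ψ : ι → ℂ) : Matrix ι ι ℂ :=
  fun x y => ψ x * star (ψ y)

/-- Partial trace over the second tensor factor. -/
noncomputable def ptraceB {dA dB : ℕ}
    (ρ : Matrix (Fin dA × Fin dB) (Fin dA × Fin dB) ℂ) : Matrix (Fin dA) (Fin dA) ℂ :=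
  fun a a' => ∑ b, ρ (a, b) (a', b)

section helpers
open Matrix

attribute [local instance] Matrix.frobeniusNormedAddCommGroup

theorem aux_frob_sq {m n : Type} [Fintype m] [Fintype n] (A : Matrix m n ℂ) :
    ‖A‖ ^ 2 = ∑ i, ∑ j, ‖A i j‖ ^ 2 := by
  rw [Matrix.frobenius_norm_def, ← Real.sqrt_eq_rpow, Real.sq_sqrt]
  · simp
  · positivity

theorem aux_frob_l2 {m n : Type} [Fintype m] [Fintype n] (f : m × n → ℂ) :
    ‖(Matrix.of fun a b => f (a, b) : Matrix m n ℂ)‖ = l2norm f := by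
  rw [l2norm, Fintype.sum_prod_type, ← Real.sqrt_sq (norm_nonneg _), aux_frob_sq]
  simp

theorem aux_trace {n : Type} [Fintype n] (A : Matrix n n ℂ) (hA : A.IsHermitian) :
    (A * A).trace.re = ‖A‖ ^ 2 := by
  rw [aux_frob_sq, Matrix.trace, Complex.re_sum]
  refine Finset.sum_congr rfl fun i _ => ?_
  rw [Matrix.diag_apply, Matrix.mul_apply, Complex.re_sum]
  refine Finset.sum_congr rfl fun j _ => ?_
  rw [← hA.apply j i, ← Complex.normSq_eq_norm_sq, Complex.star_def, Complex.mul_conj]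
  simp

theorem aux_ptrace {dA dB : ℕ} (f : Fin dA × Fin dB → ℂ) :
    ptraceB (dyad f) = (Matrix.of fun a b => f (a, b)) * (Matrix.of fun a b => f (a, b))ᴴ := by
  ext a a'
  simp [ptraceB, dyad, Matrix.mul_apply]

theorem aux_rank {n : Type} [Fintype n] [DecidableEq n] (A : Matrix n n ℂ) (hA : A.IsHermitian)
    (ht : A.trace = 1) (D : ℕ) (hD : A.rank ≤ D) : 1 / (D : ℝ) ≤ (A * A).trace.re := by
  have h1 : ∑ i, hA.eigenvalues i = 1 := by
    have := hA.trace_eq_sum_eigenvalues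
    rw [ht] at this
    have h' := congrArg Complex.re this
    simpa using h'.symm
  have h2 : (A * A).trace.re = ∑ i, hA.eigenvalues i ^ 2 := by
    have h : (A * A).trace = ∑ i, ((hA.eigenvalues i : ℂ)) ^ 2 := by
      conv_lhs => rw [hA.spectral_theorem]
      rw [← map_mul, Unitary.conjStarAlgAut_apply, Matrix.trace_mul_cycle]
      simp [Matrix.trace, pow_two]
    rw [h]
    exact_mod_cast rfl
  rw [h2]
  rw [hA.rank_eq_card_non_zero_eigs, Fintype.card_subtype] at hD
  set s := Finset.univ.filter (fun i => hA.eigenvalues i ≠ 0) with hs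
  have h3 : ∑ i ∈ s, hA.eigenvalues i = 1 := by
    rw [← h1, hs, Finset.sum_filter_ne_zero]
  have h4 := sq_sum_le_card_mul_sum_sq (s := s) (f := hA.eigenvalues)
  rw [h3] at h4
  have h5 : ∑ i ∈ s, hA.eigenvalues i ^ 2 ≤ ∑ i, hA.eigenvalues i ^ 2 :=
    Finset.sum_le_univ_sum_of_nonneg fun i => sq_nonneg _
  have h6 : 0 ≤ ∑ i ∈ s, hA.eigenvalues i ^ 2 := Finset.sum_nonneg fun i _ => sq_nonneg _
  have h7 : (s.card : ℝ) ≤ D := by exact_mod_cast hD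
  rcases Nat.eq_zero_or_pos D with h0 | h0
  · simp only [h0, Nat.cast_zero, div_zero]; linarith
  · have : (0 : ℝ) < D := by exact_mod_cast h0
    rw [div_le_iff₀ this]
    nlinarith

theorem aux_main {m n : Type} [Fintype m] [Fintype n] (M N : Matrix m n ℂ)
    (hM : ‖M‖ = 1) (hN : ‖N‖ = 1) (ε : ℝ) (h : ‖M - N‖ ≤ ε) :
    ‖N * Nᴴ‖ ^ 2 - 4 * ε ≤ ‖M * Mᴴ‖ ^ 2 := by
  have a1 : ‖M * Mᴴ‖ ≤ 1 := by
    simpa [hM] using Matrix.frobenius_norm_mul M Mᴴ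
  have a2 : ‖N * Nᴴ‖ ≤ 1 := by
    simpa [hN] using Matrix.frobenius_norm_mul N Nᴴ
  have e : N * Nᴴ = M * Mᴴ - (M * (M - N)ᴴ + (M - N) * Nᴴ) := by
    simp [Matrix.mul_sub, Matrix.sub_mul]
  have b1 : ‖M * (M - N)ᴴ‖ ≤ ε := by
    have := Matrix.frobenius_norm_mul M (M - N)ᴴ
    rw [hM, Matrix.frobenius_norm_conjTranspose] at this
    linarith
  have b2 : ‖(M - N) * Nᴴ‖ ≤ ε := by
    have := Matrix.frobenius_norm_mul (M - N) Nᴴ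
    rw [Matrix.frobenius_norm_conjTranspose, hN] at this
    linarith
  have c : ‖N * Nᴴ‖ ≤ ‖M * Mᴴ‖ + 2 * ε := by
    have c1 := norm_sub_le (M * Mᴴ) (M * (M - N)ᴴ + (M - N) * Nᴴ)
    have c2 := norm_add_le (M * (M - N)ᴴ) ((M - N) * Nᴴ)
    rw [← e] at c1
    linarith
  have p1 := norm_nonneg (M * Mᴴ)
  have p2 := norm_nonneg (N * Nᴴ)
  have p3 : 0 ≤ ε := (norm_nonneg _).trans h
  nlinarith [mul_nonneg (add_nonneg p1 p2) (sub_nonneg.2 c), mul_nonneg p3 (sub_nonneg.2 a1),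
    mul_nonneg p3 (sub_nonneg.2 a2)]

theorem aux_trace_one {dA dB : ℕ} (f : Fin dA × Fin dB → ℂ) (hf : l2norm f = 1) :
    (ptraceB (dyad f)).trace = 1 := by
  have h : ∑ x, ‖f x‖ ^ 2 = 1 := by
    rw [l2norm, Real.sqrt_eq_one] at hf
    exact hf
  rw [Fintype.sum_prod_type] at h
  simp only [Matrix.trace, ptraceB, dyad, Matrix.diag_apply, Complex.star_def, Complex.mul_conj,
    Complex.normSq_eq_norm_sq]
  exact_mod_cast h

end helpers

theorem statement_10 (dA dB D : ℕ) (ε : ℝ) (hε : 0 ≤ ε)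
    (ψ φ : Fin dA × Fin dB → ℂ) (hψ : l2norm ψ = 1) (hφ : l2norm φ = 1)
    (hclose : l2norm (fun x => ψ x - φ x) ≤ ε)
    -- `φ` has Schmidt rank at most `D`
    (hrank : (ptraceB (dyad φ)).rank ≤ D) :
    1 / (D : ℝ) - 4 * ε ≤ ((ptraceB (dyad ψ) * ptraceB (dyad ψ)).trace).re := by
  have H : ∀ f : Fin dA × Fin dB → ℂ, (ptraceB (dyad f)).IsHermitian := fun f => by
    rw [aux_ptrace]; exact Matrix.isHermitian_mul_conjTranspose_self _
  have h1 := aux_rank _ (H φ) (aux_trace_one φ hφ) D hrank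
  rw [aux_trace _ (H φ), aux_ptrace] at h1
  rw [aux_trace _ (H ψ), aux_ptrace]
  rw [← aux_frob_l2] at hψ hφ hclose
  have h2 := aux_main _ _ hψ hφ ε hclose
  linarith
end

section
/- Let ψ : (Fin N → Fin d) → ℂ be a coefficient tensor such that for every m ∈ {1,…,N−1} the Schmidt rank of ψ across the subset {1,…,m} is at most D. Then ψ is exactly an open-boundary matrix product state of bond dimension at most D: there exist natural numbers D₁ = D_{N+1} = 1 and D_n ≤ D for 2 ≤ n ≤ N, and matrices A⁽ⁿ⁾(i) ∈ Matrix (Fin D_n) (Fin D_{n+1}) ℂ for each n ∈ {1,…,N} and i ∈ Fin d, such that for all i : Fin N → Fin d, ψ(i) equals the unique entry of the 1 × 1 matrix A⁽¹⁾(i 1) * A⁽²⁾(i 2) * ⋯ * A⁽ᴺ⁾(i N). -/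
/-- The ordered product `M 0 * M 1 * ⋯ * M (k-1)` of a chain of rectangular matrices with
compatible bond dimensions `Dn`. -/
noncomputable def chainProd (Dn : ℕ → ℕ)
    (M : (n : ℕ) → Matrix (Fin (Dn n)) (Fin (Dn (n + 1))) ℂ) :
    (k : ℕ) → Matrix (Fin (Dn 0)) (Fin (Dn k)) ℂ
  | 0 => 1
  | k + 1 => chainProd Dn M k * M k

def rowFn {N d : ℕ} (ψ : (Fin N → Fin d) → ℂ) (m : ℕ) (j : ℕ → Fin d) : (ℕ → Fin d) → ℂ :=
  fun k => ψ fun n => if (n : ℕ) < m then j n else k n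

def rowSp {N d : ℕ} (ψ : (Fin N → Fin d) → ℂ) (m : ℕ) : Submodule ℂ ((ℕ → Fin d) → ℂ) :=
  Submodule.span ℂ (Set.range (rowFn ψ m))

theorem rowSp_le {N d : ℕ} (ψ : (Fin N → Fin d) → ℂ) (m : ℕ) :
    ∃ L : (({n : Fin N // n ∉ Finset.univ.filter fun n : Fin N => (n : ℕ) < m} → Fin d) → ℂ)
        →ₗ[ℂ] ((ℕ → Fin d) → ℂ), rowSp ψ m ≤ Submodule.map L (Submodule.span ℂ (Set.range
      (schmidtMat ψ (Finset.univ.filter fun n : Fin N => (n : ℕ) < m)).row)) := by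
  refine ⟨LinearMap.funLeft ℂ ℂ (fun k : ℕ → Fin d => fun n => k (n.1 : ℕ)), ?_⟩
  rw [rowSp, Submodule.span_le]
  rintro _ ⟨j, rfl⟩
  refine ⟨_, Submodule.subset_span ⟨fun n => j (n.1 : ℕ), rfl⟩, ?_⟩
  funext k
  simp [LinearMap.funLeft_apply, schmidtMat, rowFn, Matrix.row]

theorem rowSp_fd {N d : ℕ} (ψ : (Fin N → Fin d) → ℂ) (m : ℕ) :
    FiniteDimensional ℂ (rowSp ψ m) ∧ Module.finrank ℂ (rowSp ψ m) ≤
      schmidtRank ψ (Finset.univ.filter fun n : Fin N => (n : ℕ) < m) := by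
  obtain ⟨L, hL⟩ := rowSp_le ψ m
  refine ⟨Submodule.finiteDimensional_of_le hL, ?_⟩
  rw [schmidtRank, Matrix.rank_eq_finrank_span_row]
  exact (Submodule.finrank_mono hL).trans (Submodule.finrank_map_le _ _)

theorem rowSp_step {N d : ℕ} (ψ : (Fin N → Fin d) → ℂ) (m : ℕ) (s : Fin d)
    (v : (ℕ → Fin d) → ℂ) (hv : v ∈ rowSp ψ m) :
    (fun k => v (Function.update k m s)) ∈ rowSp ψ (m + 1) := by
  have : rowSp ψ m ≤ Submodule.comap
      (LinearMap.funLeft ℂ ℂ (fun k : ℕ → Fin d => Function.update k m s)) (rowSp ψ (m+1)) := by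
    rw [rowSp, Submodule.span_le]
    rintro _ ⟨j, rfl⟩
    refine Submodule.subset_span ⟨Function.update j m s, ?_⟩
    funext k
    simp only [rowFn, LinearMap.funLeft_apply]
    congr 1
    funext n
    rcases lt_trichotomy (n : ℕ) m with h | h | h
    · simp [h, Nat.lt_succ_of_lt h, h.ne]
    · simp [h]
    · have h1 : ¬ ((n : ℕ) < m) := by omega
      have h2 : ¬ ((n : ℕ) < m + 1) := by omega
      simp [h1, h2, h.ne']
  exact this hv

theorem exists_fam {N d : ℕ} (D : ℕ) (hN : 0 < N) (hd : 0 < d) (ψ : (Fin N → Fin d) → ℂ)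
    (hup : ∀ m : ℕ, 1 ≤ m → m ≤ N - 1 →
      schmidtRank ψ (Finset.univ.filter fun n : Fin N => (n : ℕ) < m) ≤ D) (m : ℕ) :
    ∃ (Dm : ℕ) (b : Fin Dm → ((ℕ → Fin d) → ℂ)),
      (m = 0 → Dm = 1 ∧ b = fun _ y => ψ fun n => y n) ∧ (m = N → Dm = 1 ∧ b = fun _ _ => 1) ∧
      (1 ≤ m → m ≤ N - 1 → Dm ≤ D) ∧ (m < N → ∀ α, b α ∈ rowSp ψ m) ∧
      rowSp ψ m ≤ Submodule.span ℂ (Set.range b) ∨ N < m := by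
  rcases lt_trichotomy m N with h | h | h
  · rcases Nat.eq_zero_or_pos m with h0 | h0
    · subst h0
      refine ⟨1, fun _ y => ψ fun n => y n, Or.inl ⟨fun _ => ⟨rfl, rfl⟩, by omega, by omega, ?_, ?_⟩⟩
      · intro _ _
        refine Submodule.subset_span ⟨fun _ => ⟨0, hd⟩, ?_⟩
        funext k; simp [rowFn]
      · rw [rowSp, Submodule.span_le]
        rintro _ ⟨j, rfl⟩
        refine Submodule.subset_span ⟨0, ?_⟩
        funext k; simp [rowFn]
    · haveI := (rowSp_fd ψ m).1
      let B := Module.finBasis ℂ (rowSp ψ m)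
      refine ⟨_, fun α => (B α : (ℕ → Fin d) → ℂ), Or.inl ⟨by omega, by omega, ?_, ?_, ?_⟩⟩
      · intro h1 h2
        exact (rowSp_fd ψ m).2.trans (hup m h1 h2)
      · intro _ α; exact (B α).2
      · have : Set.range (fun α => (B α : (ℕ → Fin d) → ℂ)) =
            (rowSp ψ m).subtype '' Set.range B := by
          rw [← Set.range_comp]; rfl
        rw [this, Submodule.span_image, B.span_eq]
        simp
  · refine ⟨1, fun _ _ => 1, Or.inl ⟨by omega, fun _ => ⟨rfl, rfl⟩, by omega, by omega, ?_⟩⟩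
    rw [rowSp, Submodule.span_le]
    rintro _ ⟨j, rfl⟩
    have : rowFn ψ m j = (ψ fun n => j n) • (fun _ => 1 : (ℕ → Fin d) → ℂ) := by
      funext k; simp [rowFn, h]
    rw [this]
    exact Submodule.smul_mem _ _ (Submodule.subset_span ⟨0, rfl⟩)
  · exact ⟨0, fun _ _ => 0, Or.inr h⟩

theorem statement_11 (N d D : ℕ) (hN : 0 < N) (hd : 0 < d) (hD : 0 < D)
    (ψ : (Fin N → Fin d) → ℂ)
    -- the Schmidt rank across every left-right cut `{1, …, m}` is at most `D`
    (hup : ∀ m : ℕ, 1 ≤ m → m ≤ N - 1 →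
      schmidtRank ψ (Finset.univ.filter fun n : Fin N => (n : ℕ) < m) ≤ D) :
    ∃ Dn : ℕ → ℕ, Dn 0 = 1 ∧ Dn N = 1 ∧ (∀ n : ℕ, 1 ≤ n → n ≤ N - 1 → Dn n ≤ D) ∧
      ∃ A : (n : ℕ) → Fin d → Matrix (Fin (Dn n)) (Fin (Dn (n + 1))) ℂ,
        ∀ i : Fin N → Fin d, ∀ (a : Fin (Dn 0)) (b : Fin (Dn N)),
          ψ i = chainProd Dn (fun n => A n (if h : n < N then i ⟨n, h⟩ else i ⟨0, hN⟩)) N a b := by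
  choose Dn b hb using exists_fam D hN hd ψ hup
  have hb' : ∀ m, m ≤ N → _ := fun m hm => (hb m).resolve_right (by omega)
  have hA : ∀ m (s : Fin d), ∃ A : Fin (Dn m) → Fin (Dn (m+1)) → ℂ, m < N → ∀ α y,
      b m α (Function.update y m s) = ∑ β, A α β * b (m+1) β y := by
    intro m s
    by_cases hm : m < N
    · have : ∀ α, ∃ c : Fin (Dn (m+1)) → ℂ, ∑ β, c β • b (m+1) β =
          fun y => b m α (Function.update y m s) := by
        intro α
        have h1 := rowSp_step ψ m s _ ((hb' m hm.le).2.2.2.1 hm α)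
        exact (Submodule.mem_span_range_iff_exists_fun ℂ).1 ((hb' (m+1) hm).2.2.2.2 h1)
      choose c hc using this
      refine ⟨c, fun _ α y => ?_⟩
      have := congrFun (hc α) y
      simpa using this.symm
    · exact ⟨fun _ _ => 0, fun h => absurd h hm⟩
  choose A hA using hA
  have h0 := (hb' 0 (Nat.zero_le _)).1 rfl
  have hNN := (hb' N le_rfl).2.1 rfl
  refine ⟨Dn, h0.1, hNN.1, fun n h1 h2 => (hb' n (by omega)).2.2.1 h1 h2,
    fun n s => Matrix.of (A n s), fun i a e => ?_⟩
  have key : ∀ x : ℕ → Fin d, ∀ k, k ≤ N → ∀ y,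
      ∑ β, chainProd Dn (fun n => Matrix.of (A n (x n))) k a β * b k β y =
        ψ fun n => if (n : ℕ) < k then x n else y n := by
    intro x k
    induction k with
    | zero =>
      intro _ y
      simp [chainProd, Matrix.one_apply, h0.2]
    | succ k ih =>
      intro hk y
      have h1 := ih (by omega) (Function.update y k (x k))
      have h2 : (fun n : Fin N => if (n : ℕ) < k then x n else Function.update y k (x k) n) =
          fun n : Fin N => if (n : ℕ) < k + 1 then x n else y n := by
        funext n
        rcases lt_trichotomy (n : ℕ) k with h | h | h
        · simp [h, Nat.lt_succ_of_lt h]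
        · simp [h]
        · have h1 : ¬ ((n : ℕ) < k) := by omega
          have h2 : ¬ ((n : ℕ) < k + 1) := by omega
          simp [h1, h2, h.ne']
      rw [h2] at h1
      rw [← h1]
      simp only [hA k (x k) hk, chainProd, Matrix.mul_apply, Matrix.of_apply, Finset.sum_mul,
        Finset.mul_sum]
      rw [Finset.sum_comm]
      simp only [mul_assoc]
  have hk := key (fun n => if h : n < N then i ⟨n, h⟩ else i ⟨0, hN⟩) N le_rfl (fun _ => ⟨0, hd⟩)
  haveI : Subsingleton (Fin (Dn N)) := by rw [hNN.1]; infer_instance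
  rw [Fintype.sum_subsingleton _ e] at hk
  simp only [hNN.2, mul_one] at hk
  rw [hk]
  congr 1
  funext n
  simp
end

section
/- Let N ≥ 1 and let W_N : (Fin N → Fin 2) → ℂ be the coefficient tensor of the W state: W_N(i) = 1 if exactly one n ∈ Fin N has i n = 1, and W_N(i) = 0 otherwise. For ε ≠ 0 let v_±(ε) : Fin 2 → ℂ be v_±(ε)(0) = 1, v_±(ε)(1) = ±ε, and let f_ε(i) = (1/(2ε))·(∏_{n} v_+(ε)(i n) − ∏_{n} v_-(ε)(i n)). Then f_ε converges to W_N as ε → 0 (in the ℓ²-norm on coefficient tensors); in particular the W state has border rank at most 2, being a limit of sums of two product states. -/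
/-- The coefficient tensor of the W state on `N` qubits. -/
noncomputable def Wstate (N : ℕ) : (Fin N → Fin 2) → ℂ :=
  fun i => if (Finset.univ.filter fun n => i n = 1).card = 1 then 1 else 0

theorem aux_prod {N : ℕ} (i : Fin N → Fin 2) (c : ℂ) :
    (∏ n, if i n = 0 then (1 : ℂ) else c) = c ^ (Finset.univ.filter fun n => i n = 1).card := by
  have h : ∀ n, (if i n = 0 then (1 : ℂ) else c) = if i n = 1 then c else 1 := by
    intro n
    generalize i n = a
    fin_cases a <;> simp
  simp only [h]
  rw [Finset.prod_ite]
  simp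

theorem aux_lim (k : ℕ) :
    Filter.Tendsto (fun ε : ℂ => (1 / (2 * ε)) * (ε ^ k - (-ε) ^ k) - if k = 1 then 1 else 0)
      (nhdsWithin 0 ({0}ᶜ : Set ℂ)) (nhds 0) := by
  rcases k with _ | _ | k
  · simp
  · refine tendsto_const_nhds.congr' ?_
    filter_upwards [self_mem_nhdsWithin] with ε hε
    have : ε ≠ 0 := hε
    simp
    field_simp
    ring
  · have h : Filter.Tendsto (fun ε : ℂ => (1 / 2) * ε ^ (k + 1) * (1 - (-1) ^ (k + 2)))
        (nhdsWithin 0 ({0}ᶜ : Set ℂ)) (nhds 0) := by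
      have hc : Continuous (fun ε : ℂ => (1 / 2) * ε ^ (k + 1) * (1 - (-1) ^ (k + 2))) := by
        fun_prop
      have := hc.tendsto 0
      simp at this
      exact (by simpa using this : Filter.Tendsto _ _ _).mono_left nhdsWithin_le_nhds
    refine h.congr' ?_
    filter_upwards [self_mem_nhdsWithin] with ε hε
    have : ε ≠ 0 := hε
    rw [neg_pow ε, if_neg (by omega)]
    field_simp
    ring

theorem statement_13 (N : ℕ) (hN : 1 ≤ N) :
    Filter.Tendsto
      (fun ε : ℂ => l2norm fun i : Fin N → Fin 2 =>
        (1 / (2 * ε)) *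
          ((∏ n, if i n = 0 then (1 : ℂ) else ε) - ∏ n, if i n = 0 then (1 : ℂ) else -ε)
        - Wstate N i)
      (nhdsWithin 0 ({0}ᶜ : Set ℂ)) (nhds 0) := by
  unfold l2norm Wstate
  simp only [aux_prod]
  have h : Filter.Tendsto (fun ε : ℂ => ∑ i : Fin N → Fin 2,
      ‖(1 / (2 * ε)) * (ε ^ (Finset.univ.filter fun n => i n = 1).card
        - (-ε) ^ (Finset.univ.filter fun n => i n = 1).card)
        - if (Finset.univ.filter fun n => i n = 1).card = 1 then 1 else 0‖ ^ 2)
      (nhdsWithin 0 ({0}ᶜ : Set ℂ)) (nhds (∑ i : Fin N → Fin 2, ‖(0 : ℂ)‖ ^ 2)) :=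
    tendsto_finsetSum _ fun i _ => ((aux_lim _).norm).pow 2
  have h2 := (Real.continuous_sqrt.tendsto _).comp h
  simpa [Function.comp_def] using h2
end

section
/- Let N ≥ 2 and let W_N : (Fin N → Fin 2) → ℂ be the coefficient tensor with W_N(i) = 1 if exactly one n ∈ Fin N has i n = 1, and W_N(i) = 0 otherwise. Then for every subset S of the sites with 1 ≤ |S| ≤ N − 1, the Schmidt rank of W_N across S equals 2. In particular, W_N has the exact MPS-up property with bound 2. -/
def ones17 {ι : Type*} [Fintype ι] (j : ι → Fin 2) : ℕ :=
  ∑ n, if j n = 1 then 1 else 0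

lemma ones17_zero {ι : Type*} [Fintype ι] : ones17 (fun _ : ι => (0 : Fin 2)) = 0 := by
  simp [ones17]

lemma ones17_single {ι : Type*} [Fintype ι] [DecidableEq ι] (a : ι) :
    ones17 (fun x : ι => if x = a then (1 : Fin 2) else 0) = 1 := by
  unfold ones17
  rw [Finset.sum_eq_single a]
  · simp
  · intro b _ hb
    simp [hb]
  · simp

lemma schmidt_entry17 (N : ℕ) (S : Finset (Fin N)) (j : {n : Fin N // n ∈ S} → Fin 2)
    (k : {n : Fin N // n ∉ S} → Fin 2) :
    schmidtMat (Wstate N) S j k = if ones17 j + ones17 k = 1 then 1 else 0 := by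
  unfold schmidtMat Wstate
  have h : (Finset.univ.filter fun n : Fin N =>
      (if h : n ∈ S then j ⟨n, h⟩ else k ⟨n, h⟩) = 1).card = ones17 j + ones17 k := by
    rw [Finset.card_filter, ← Fintype.sum_subtype_add_sum_subtype (fun n => n ∈ S)]
    unfold ones17
    congr 1
    · exact Finset.sum_congr (by ext; simp) fun x _ => by simp [x.2]
    · exact Finset.sum_congr (by ext; simp) fun x _ => by simp [x.2]
  simp only [h]

lemma schmidt_upper17 (N : ℕ) (S : Finset (Fin N)) : schmidtRank (Wstate N) S ≤ 2 := by
  unfold schmidtRank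
  have h : schmidtMat (Wstate N) S =
      (Matrix.of fun j (t : Fin 2) => if ones17 j = t.val then (1 : ℂ) else 0) *
      (Matrix.of fun (t : Fin 2) k => if ones17 k + t.val = 1 then (1 : ℂ) else 0) := by
    ext j k
    rw [schmidt_entry17, Matrix.mul_apply, Fin.sum_univ_two]
    simp only [Matrix.of_apply, Fin.val_zero, Fin.val_one]
    generalize ones17 j = a
    generalize ones17 k = b
    rcases a with _ | _ | a
    · simp
    · simp
    · simp
      omega
  rw [h]
  exact (Matrix.rank_mul_le_left _ _).trans ((Matrix.rank_le_card_width _).trans (by simp))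

theorem statement_17 (N : ℕ) (hN : 2 ≤ N) :
    (∀ S : Finset (Fin N), 1 ≤ S.card → S.card ≤ N - 1 → schmidtRank (Wstate N) S = 2) ∧
    (∀ S : Finset (Fin N), schmidtRank (Wstate N) S ≤ 2) := by
  refine ⟨fun S h1 h2 => le_antisymm (schmidt_upper17 N S) ?_, schmidt_upper17 N⟩
  obtain ⟨a, ha⟩ := Finset.card_pos.mp h1
  obtain ⟨b, hb⟩ : ∃ b, b ∉ S := by
    by_contra! hc
    have : S = Finset.univ := Finset.eq_univ_iff_forall.mpr hc
    rw [this, Finset.card_univ, Fintype.card_fin] at h2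
    omega
  have key : (schmidtMat (Wstate N) S).submatrix
      ![fun _ => 0, fun x => if x = ⟨a, ha⟩ then 1 else 0]
      ![fun x => if x = ⟨b, hb⟩ then 1 else 0, fun _ => 0] = (1 : Matrix (Fin 2) (Fin 2) ℂ) := by
    ext s t
    rw [Matrix.submatrix_apply, schmidt_entry17]
    fin_cases s <;> fin_cases t <;> simp [ones17_zero, ones17_single]
  have := Matrix.rank_submatrix_le (schmidtMat (Wstate N) S)
      ![fun _ => 0, fun x => if x = ⟨a, ha⟩ then 1 else 0]
      ![fun x => if x = ⟨b, hb⟩ then 1 else 0, fun _ => 0]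
  rw [key, Matrix.rank_one, Fintype.card_fin] at this
  exact this
end

section
/- Let 0 ≤ n ≤ N and let D_{n,N} : (Fin N → Fin 2) → ℂ be the coefficient tensor of the Dicke state: D_{n,N}(i) = 1 if exactly n indices among i 1, …, i N equal 1, and D_{n,N}(i) = 0 otherwise. Then for every subset S of the sites, the Schmidt rank of D_{n,N} across S is at most min(n, N − n) + 1. In particular, D_{n,N} has the exact MPS-up property with bound min(n, N − n) + 1. -/
/-- The coefficient tensor of the Dicke state with `n` excitations on `N` qubits. -/
noncomputable def Dicke (n N : ℕ) : (Fin N → Fin 2) → ℂ :=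
  fun i => if (Finset.univ.filter fun m => i m = 1).card = n then 1 else 0

theorem rank_aux {α β : Type*} [Fintype α] [Fintype β] (a : α → ℕ) (b : β → ℕ) (m : ℕ)
    (M : Matrix α β ℂ) (hM : ∀ j k, M j k = if a j + b k = m then 1 else 0) :
    M.rank ≤ m + 1 := by
  classical
  have : M = (Matrix.of fun j (r : Fin (m + 1)) => if a j = (r : ℕ) then (1 : ℂ) else 0) *
      (Matrix.of fun (r : Fin (m + 1)) k => if (r : ℕ) + b k = m then (1 : ℂ) else 0) := by
    ext j k
    rw [hM, Matrix.mul_apply]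
    simp only [Matrix.of_apply]
    by_cases hj : a j < m + 1
    · rw [Finset.sum_eq_single (⟨a j, hj⟩ : Fin (m + 1))]
      · simp
      · intro r _ hr
        have : a j ≠ (r : ℕ) := fun h => hr (Fin.ext h.symm)
        simp [this]
      · simp
    · rw [if_neg (by omega), Finset.sum_eq_zero]
      intro r _
      have : a j ≠ (r : ℕ) := by have := r.2; omega
      simp [this]
  rw [this]
  refine (Matrix.rank_mul_le_left _ _).trans ((Matrix.rank_le_card_width _).trans ?_)
  simp

theorem count_aux {N : ℕ} (S : Finset (Fin N)) (v : Fin 2)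
    (j : {n : Fin N // n ∈ S} → Fin 2) (k : {n : Fin N // n ∉ S} → Fin 2) :
    (Finset.univ.filter fun m : Fin N =>
      (if h : m ∈ S then j ⟨m, h⟩ else k ⟨m, h⟩) = v).card =
    (Finset.univ.filter fun x => j x = v).card + (Finset.univ.filter fun x => k x = v).card := by
  simp only [Finset.card_filter]
  rw [← Fintype.sum_subtype_add_sum_subtype (fun m : Fin N => m ∈ S)]
  congr 1
  · exact Finset.sum_congr (by ext; simp) fun x _ => by simp [x.2]
  · exact Finset.sum_congr (by ext; simp) fun x _ => by simp [x.2]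

theorem compl_aux {N : ℕ} (i : Fin N → Fin 2) :
    (Finset.univ.filter fun m => i m = 1).card + (Finset.univ.filter fun m => i m = 0).card = N := by
  have h := Finset.card_filter_add_card_filter_not (s := (Finset.univ : Finset (Fin N)))
    (fun m => i m = 1)
  have e : (Finset.univ.filter fun m => i m = 0) = Finset.univ.filter fun m => ¬ i m = 1 := by
    ext m
    simp only [Finset.mem_filter, Finset.mem_univ, true_and]
    omega
  rw [e, h]
  simp

theorem statement_18 (n N : ℕ) (h : n ≤ N) :
    ∀ S : Finset (Fin N), schmidtRank (Dicke n N) S ≤ min n (N - n) + 1 := by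
  intro S
  have h1 : schmidtRank (Dicke n N) S ≤ n + 1 := by
    refine rank_aux (fun j => (Finset.univ.filter fun x => j x = 1).card)
      (fun k => (Finset.univ.filter fun x => k x = 1).card) n _ ?_
    intro j k
    simp only [schmidtMat, Dicke, count_aux]
  have h2 : schmidtRank (Dicke n N) S ≤ (N - n) + 1 := by
    refine rank_aux (fun j => (Finset.univ.filter fun x => j x = 0).card)
      (fun k => (Finset.univ.filter fun x => k x = 0).card) (N - n) _ ?_
    intro j k
    have hc := compl_aux (fun m => if h : m ∈ S then j ⟨m, h⟩ else k ⟨m, h⟩)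
    rw [count_aux, count_aux] at hc
    simp only [schmidtMat, Dicke, count_aux]
    congr 1
    apply propext
    omega
  omega
end
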